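/- For the Jacobi–Piñeiro weights with p = 2: let α₁, α₂, β > -1 with α₁ - α₂ ∉ ℤ, and n₁, n₂ ∈ ℕ. Define for i ∈ {1,2} the polynomial P^{(i)}(x) = (-1)^{n₁+n₂-1} \frac{(α₁+β+n₁+n₂)_{n₁}(α₂+β+n₁+n₂)_{n₂}}{(n_i-1)!\,(α̂_i-α_i)_{n̂_i}} \frac{Γ(α_i+β+n₁+n₂)}{Γ(β+n₁+n₂)Γ(α_i+1)}\, {}_3F_2(-n_i+1, α_i+β+n₁+n₂, α_i-α̂_i-n̂_i+1; α_i+1, α_i-α̂_i+1; x), where (α̂₁,n̂₁)=(α₂,n₂), (α̂₂,n̂₂)=(α₁,n₁). Then for all j ∈ {0,…,n₁+n₂-2}, ∑_{i=1}^{2} ∫₀¹ x^j P^{(i)}(x) x^{α_i} (1-x)^β dx = 0, and for j = n₁+n₂-1 this sum equals 1. -/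

import Mathlib

/-- Pochhammer symbol `(x)ₙ` on `ℝ`. -/
noncomputable def poch (x : ℝ) (n : ℕ) : ℝ := ∏ s ∈ Finset.range n, (x + s)

/-- The type I Jacobi–Piñeiro polynomial for two weights, with parameters
`(α, α̂, β)` and degrees `(n, n̂)` (here `α, n` are the data of the chosen index `i`
and `α̂, n̂` those of the other index). -/
noncomputable def JP2 (α αh β : ℝ) (n nh : ℕ) (x : ℝ) : ℝ :=
  (-1) ^ (n + nh - 1) *
    (poch (α + β + n + nh) n * poch (αh + β + n + nh) nh /
      (((n - 1).factorial : ℝ) * poch (αh - α) nh)) *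
    (Real.Gamma (α + β + n + nh) / (Real.Gamma (β + n + nh) * Real.Gamma (α + 1))) *
    ∑ l ∈ Finset.range n,
      poch (-(n : ℝ) + 1) l * poch (α + β + n + nh) l * poch (α - αh - nh + 1) l /
        (poch (α + 1) l * poch (α - αh + 1) l * (l.factorial : ℝ)) * x ^ l

lemma jp_beta_congr (a b x : ℝ) (hx : x ∈ Set.Ioc (0:ℝ) 1) :
    (x : ℂ) ^ ((a : ℂ) - 1) * (1 - (x : ℂ)) ^ ((b : ℂ) - 1)
      = ((x ^ (a - 1) * (1 - x) ^ (b - 1) : ℝ) : ℂ) := by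
  push_cast
  rw [Complex.ofReal_cpow hx.1.le, Complex.ofReal_cpow (by linarith [hx.2])]
  push_cast
  rfl

lemma jp_beta_integrable (a b : ℝ) (ha : 0 < a) (hb : 0 < b) :
    IntervalIntegrable (fun x : ℝ => x ^ (a - 1) * (1 - x) ^ (b - 1)) MeasureTheory.volume 0 1 := by
  have h := Complex.betaIntegral_convergent (u := a) (v := b) (by simpa) (by simpa)
  rw [intervalIntegrable_iff_integrableOn_Ioc_of_le zero_le_one] at h ⊢
  have h2 := h.re
  refine MeasureTheory.IntegrableOn.congr_fun (f := fun x : ℝ =>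
    RCLike.re ((x : ℂ) ^ ((a : ℂ) - 1) * (1 - (x : ℂ)) ^ ((b : ℂ) - 1))) h2 ?_ measurableSet_Ioc
  intro x hx
  simp only
  rw [jp_beta_congr a b x hx]
  simp

lemma jp_beta (a b : ℝ) (ha : 0 < a) (hb : 0 < b) :
    ∫ x in (0:ℝ)..1, x ^ (a - 1) * (1 - x) ^ (b - 1)
      = Real.Gamma a * Real.Gamma b / Real.Gamma (a + b) := by
  have h := ProbabilityTheory.beta_eq_betaIntegralReal a b ha hb
  rw [ProbabilityTheory.beta] at h
  rw [h, Complex.betaIntegral]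
  have : ∫ x in (0:ℝ)..1, (x : ℂ) ^ ((a : ℂ) - 1) * (1 - (x : ℂ)) ^ ((b : ℂ) - 1)
      = ∫ x in (0:ℝ)..1, ((x ^ (a - 1) * (1 - x) ^ (b - 1) : ℝ) : ℂ) := by
    rw [intervalIntegral.integral_of_le zero_le_one, intervalIntegral.integral_of_le zero_le_one]
    exact MeasureTheory.setIntegral_congr_fun measurableSet_Ioc
      (fun x hx => jp_beta_congr a b x hx)
  rw [this, intervalIntegral.integral_ofReal, Complex.ofReal_re]

lemma jp_gamma_poch (a : ℝ) (ha : 0 < a) (l : ℕ) :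
    poch a l * Real.Gamma a = Real.Gamma (a + l) := by
  induction l with
  | zero => simp [poch]
  | succ l ih =>
    have : (a + l : ℝ) ≠ 0 := by positivity
    rw [poch, Finset.prod_range_succ, ← poch]
    push_cast
    rw [← add_assoc, Real.Gamma_add_one this, ← ih]
    ring

lemma jp_poch_pos (a : ℝ) (ha : 0 < a) (l : ℕ) : 0 < poch a l :=
  Finset.prod_pos fun s _ => by positivity

lemma jp_prod_erase (f : ℕ → ℝ) (l m : ℕ) :
    ∏ k ∈ (Finset.range (l + 1 + m)).erase l, f k
      = (∏ k ∈ Finset.range l, f k) * ∏ k ∈ Finset.range m, f (l + 1 + k) := by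
  induction m with
  | zero => simp [Finset.range_add_one]
  | succ m ih =>
    rw [← add_assoc, Finset.range_add_one, Finset.erase_insert_of_ne (by omega),
      Finset.prod_insert (by simp), ih, Finset.prod_range_succ]
    ring

lemma jp_fact (l : ℕ) : ∏ k ∈ Finset.range l, ((l : ℝ) - k) = l.factorial := by
  induction l with
  | zero => simp
  | succ l ih =>
    rw [Finset.prod_range_succ', Nat.factorial_succ]
    push_cast
    rw [← ih]
    simp only [add_sub_add_right_eq_sub]
    ring

lemma jp_fact2 (l m : ℕ) :
    ∏ k ∈ Finset.range m, ((l : ℝ) - ((l + 1 + k : ℕ) : ℝ)) = (-1) ^ m * m.factorial := by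
  induction m with
  | zero => simp
  | succ m ih =>
    rw [Finset.prod_range_succ, ih, Nat.factorial_succ]
    push_cast
    ring

lemma jp_fact3 (l m : ℕ) :
    poch (-((l + 1 + m : ℕ) : ℝ) + 1) l * m.factorial = (-1) ^ l * (l + m).factorial := by
  induction l with
  | zero => simp [poch]
  | succ l ih =>
    rw [show l + 1 + m = (l + m) + 1 by omega, Nat.factorial_succ]
    rw [poch, Finset.prod_range_succ']
    rw [poch] at ih
    push_cast at ih ⊢
    have : ∏ k ∈ Finset.range l, (-((l:ℝ) + 1 + 1 + m) + 1 + (k + 1))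
      = ∏ k ∈ Finset.range l, (-((l:ℝ) + 1 + m) + 1 + k) :=
      Finset.prod_congr rfl fun k _ => by ring
    rw [this]
    linear_combination (-((l:ℝ) + m + 1 + 1) + 1) * ih

lemma jp_shift (d : ℝ) (nh l : ℕ) :
    poch (d - nh + 1) l * ∏ m ∈ Finset.range nh, (d + l - m)
      = (-1) ^ nh * poch (-d) nh * poch (d + 1) l := by
  induction l with
  | zero =>
    simp only [poch, Finset.range_zero, Finset.prod_empty, Nat.cast_zero, add_zero, one_mul, mul_one]
    have : ((-1:ℝ)) ^ nh = ∏ _m ∈ Finset.range nh, (-1:ℝ) := by simp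
    rw [this, ← Finset.prod_mul_distrib]
    exact Finset.prod_congr rfl fun k _ => by ring
  | succ l ih =>
    have e1 : poch (d - nh + 1) (l + 1) = poch (d - nh + 1) l * (d - nh + 1 + l) := by
      rw [poch, Finset.prod_range_succ, ← poch]
    have e2 : poch (d + 1) (l + 1) = poch (d + 1) l * (d + 1 + l) := by
      rw [poch, Finset.prod_range_succ, ← poch]
    have e3 : (∏ m ∈ Finset.range nh, (d + (l + 1 : ℕ) - m)) * (d + (l + 1 : ℕ) - nh)
        = (∏ m ∈ Finset.range nh, (d + l - m)) * (d + (l + 1 : ℕ)) := by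
      rw [← Finset.prod_range_succ, Finset.prod_range_succ']
      push_cast
      congr 1
      · exact Finset.prod_congr rfl fun k _ => by ring
      · ring
    rw [e1, e2]
    push_cast at e3 ⊢
    linear_combination (poch (d - nh + 1) l) * e3 + (d + 1 + l) * ih

/-- Nodal weight at the node `α + l`. -/
noncomputable def jpW (α αh : ℝ) (n nh l : ℕ) : ℝ :=
  ((∏ k ∈ (Finset.range n).erase l, ((l : ℝ) - k)) *
    ∏ m ∈ Finset.range nh, (α + l - (αh + m)))⁻¹

lemma jp_coef (α αh : ℝ) (n nh l : ℕ) (hl : l < n) (hZ : ∀ z : ℤ, α - αh ≠ (z : ℝ)) :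
    (-1) ^ (n + nh - 1) * poch (-(n : ℝ) + 1) l * poch (α - αh - nh + 1) l /
      ((n - 1).factorial * poch (αh - α) nh * poch (α - αh + 1) l * l.factorial)
      = jpW α αh n nh l := by
  obtain ⟨m, rfl⟩ : ∃ m, n = l + 1 + m := ⟨n - (l + 1), by omega⟩
  have h3 := jp_fact3 l m
  have hs := jp_shift (α - αh) nh l
  have hne : poch (α - αh + 1) l ≠ 0 := by
    refine Finset.prod_ne_zero_iff.2 fun s _ h => hZ (-(1 + s)) ?_
    push_cast
    linarith
  have hne2 : poch (αh - α) nh ≠ 0 := by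
    refine Finset.prod_ne_zero_iff.2 fun s _ h => hZ s ?_
    push_cast
    linarith
  have hne3 : ∏ m ∈ Finset.range nh, (α + l - (αh + m)) ≠ 0 := by
    refine Finset.prod_ne_zero_iff.2 fun s _ h => hZ (s - l) ?_
    push_cast
    linarith
  have hq : ∏ m ∈ Finset.range nh, (α - αh + l - m) = ∏ m ∈ Finset.range nh, (α + l - (αh + m)) :=
    Finset.prod_congr rfl fun k _ => by ring
  rw [hq, neg_sub] at hs
  rw [jpW, jp_prod_erase, jp_fact, jp_fact2]
  rw [show l + 1 + m + nh - 1 = l + m + nh by omega, show l + 1 + m - 1 = l + m by omega]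
  have f1 : (m.factorial : ℝ) ≠ 0 := by positivity
  have f2 : (l.factorial : ℝ) ≠ 0 := by positivity
  have f3 : ((l + m).factorial : ℝ) ≠ 0 := by positivity
  have g1 : poch (-((l + 1 + m : ℕ) : ℝ) + 1) l = (-1) ^ l * (l + m).factorial / m.factorial := by
    rw [eq_div_iff f1, h3]
  have g2 : poch (α - αh - nh + 1) l = (-1) ^ nh * poch (αh - α) nh * poch (α - αh + 1) l /
      ∏ m ∈ Finset.range nh, (α + l - (αh + m)) := by
    rw [eq_div_iff hne3, hs]
  rw [g1, g2]
  have s1 : ((-1 : ℝ)) ^ l * (-1) ^ l = 1 := by rw [← mul_pow]; simp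
  have s2 : ((-1 : ℝ)) ^ m * (-1) ^ m = 1 := by rw [← mul_pow]; simp
  have s3 : ((-1 : ℝ)) ^ nh * (-1) ^ nh = 1 := by rw [← mul_pow]; simp
  rw [pow_add, pow_add]
  have s0 : ((-1 : ℝ)) ^ m ≠ 0 := by simp
  generalize ((-1 : ℝ)) ^ l = a at *
  generalize ((-1 : ℝ)) ^ m = b at *
  generalize ((-1 : ℝ)) ^ nh = c at *
  generalize ∏ m ∈ Finset.range nh, (α + l - (αh + m)) = P at *
  generalize poch (αh - α) nh = Q at *
  generalize poch (α - αh + 1) l = R at *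
  field_simp
  linear_combination (b^2*c^2) * s1 + c^2 * s2 + s3

open Polynomial in
/-- The interpolation identity. -/
lemma jp_lagrange (α₁ α₂ c : ℝ) (n₁ n₂ : ℕ) (hZ : ∀ z : ℤ, α₁ - α₂ ≠ (z : ℝ))
    (h1 : 0 < α₁ + c) (h2 : 0 < α₂ + c) (p : ℝ[X]) (hp : p.degree < (n₁ + n₂ : ℕ)) :
    poch (α₁ + c) n₁ * poch (α₂ + c) n₂ *
      ((∑ l ∈ Finset.range n₁, jpW α₁ α₂ n₁ n₂ l * (p.eval (α₁ + l) / (α₁ + l + c)))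
        + ∑ l ∈ Finset.range n₂, jpW α₂ α₁ n₂ n₁ l * (p.eval (α₂ + l) / (α₂ + l + c)))
      = (-1) ^ (n₁ + n₂ + 1) * p.eval (-c) := by
  set s : Finset (ℕ ⊕ ℕ) := (Finset.range n₁).disjSum (Finset.range n₂) with hs
  let v : ℕ ⊕ ℕ → ℝ := Sum.elim (fun l => α₁ + l) (fun l => α₂ + l)
  have hv : Set.InjOn v s := by
    rintro (a | a) _ (b | b) _ h <;> simp [v] at h
    · rw [h]
    · exact (hZ (b - a) (by push_cast; linarith)).elim
    · exact (hZ (a - b) (by push_cast; linarith)).elim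
    · rw [h]
  have hcard : s.card = n₁ + n₂ := by simp [hs]
  have hx : ∀ i ∈ s, -c ≠ v i := by
    rintro (a | a) _ h <;> simp [v] at h
    · have : (0:ℝ) ≤ a := by positivity
      linarith
    · have : (0:ℝ) ≤ a := by positivity
      linarith
  have key := Lagrange.eval_interpolate_not_at_node (fun i => p.eval (v i)) hx
  rw [← Lagrange.eq_interpolate hv (by rw [hcard]; exact hp), Lagrange.eval_nodal, hs,
    Finset.sum_disjSum, Finset.prod_disjSum] at key
  have w1 : ∀ l ∈ Finset.range n₁, Lagrange.nodalWeight s v (Sum.inl l) = jpW α₁ α₂ n₁ n₂ l := by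
    intro l hl
    have : s.erase (Sum.inl l) = ((Finset.range n₁).erase l).disjSum (Finset.range n₂) := by
      ext (a | a) <;> simp [hs]
    rw [Lagrange.nodalWeight, this, Finset.prod_disjSum, jpW, mul_inv, ← Finset.prod_inv_distrib,
      ← Finset.prod_inv_distrib]
    simp [v]
  have w2 : ∀ l ∈ Finset.range n₂, Lagrange.nodalWeight s v (Sum.inr l) = jpW α₂ α₁ n₂ n₁ l := by
    intro l hl
    have : s.erase (Sum.inr l) = (Finset.range n₁).disjSum ((Finset.range n₂).erase l) := by
      ext (a | a) <;> simp [hs]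
    rw [Lagrange.nodalWeight, this, Finset.prod_disjSum, jpW, mul_inv, ← Finset.prod_inv_distrib,
      ← Finset.prod_inv_distrib]
    simp [v, mul_comm]
  have q : ∀ (a : ℝ) (n : ℕ), ∏ l ∈ Finset.range n, (-c - (a + l)) = (-1) ^ n * poch (a + c) n := by
    intro a n
    have : ((-1:ℝ)) ^ n = ∏ _m ∈ Finset.range n, (-1:ℝ) := by simp
    rw [poch, this, ← Finset.prod_mul_distrib]
    exact Finset.prod_congr rfl fun k _ => by ring
  have r1 : ∑ l ∈ Finset.range n₁, Lagrange.nodalWeight s v (Sum.inl l) * (-c - v (Sum.inl l))⁻¹ *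
      p.eval (v (Sum.inl l)) = - ∑ l ∈ Finset.range n₁,
        jpW α₁ α₂ n₁ n₂ l * (p.eval (α₁ + l) / (α₁ + l + c)) := by
    rw [← Finset.sum_neg_distrib]
    refine Finset.sum_congr rfl fun l hl => ?_
    rw [w1 l hl, show -c - v (Sum.inl l) = -(α₁ + l + c) by simp [v]; ring, inv_neg]
    simp only [v, Sum.elim_inl]
    ring
  have r2 : ∑ l ∈ Finset.range n₂, Lagrange.nodalWeight s v (Sum.inr l) * (-c - v (Sum.inr l))⁻¹ *
      p.eval (v (Sum.inr l)) = - ∑ l ∈ Finset.range n₂,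
        jpW α₂ α₁ n₂ n₁ l * (p.eval (α₂ + l) / (α₂ + l + c)) := by
    rw [← Finset.sum_neg_distrib]
    refine Finset.sum_congr rfl fun l hl => ?_
    rw [w2 l hl, show -c - v (Sum.inr l) = -(α₂ + l + c) by simp [v]; ring, inv_neg]
    simp only [v, Sum.elim_inr]
    ring
  rw [← hs, r1, r2] at key
  simp only [v, Sum.elim_inl, Sum.elim_inr] at key
  rw [q, q] at key
  rw [key, pow_add, pow_add]
  have s1 : ((-1 : ℝ)) ^ n₁ * (-1) ^ n₁ = 1 := by rw [← mul_pow]; simp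
  have s2 : ((-1 : ℝ)) ^ n₂ * (-1) ^ n₂ = 1 := by rw [← mul_pow]; simp
  generalize ((-1 : ℝ)) ^ n₁ = a at *
  generalize ((-1 : ℝ)) ^ n₂ = b at *
  generalize (∑ l ∈ Finset.range n₁, jpW α₁ α₂ n₁ n₂ l * (p.eval (α₁ + l) / (α₁ + l + c))) = S at *
  generalize (∑ l ∈ Finset.range n₂, jpW α₂ α₁ n₂ n₁ l * (p.eval (α₂ + l) / (α₂ + l + c))) = T at *
  generalize poch (α₁ + c) n₁ = A at *
  generalize poch (α₂ + c) n₂ = B at *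
  linear_combination (-A * B * (S + T) * b ^ 2) * s1 - A * B * (S + T) * s2


open Polynomial in
/-- The polynomial to be interpolated. -/
noncomputable def jpP (β : ℝ) (j M : ℕ) : ℝ[X] :=
  (∏ s ∈ Finset.range j, (X + C (1 + (s : ℝ)))) * ∏ s ∈ Finset.range M, (X + C (β + j + 2 + s))

lemma jpP_eval (β : ℝ) (j M : ℕ) (t : ℝ) :
    (jpP β j M).eval t = poch (t + 1) j * poch (t + β + j + 2) M := by
  rw [jpP, Polynomial.eval_mul, Polynomial.eval_prod, Polynomial.eval_prod, poch, poch]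
  simp [add_assoc]

lemma jpP_degree (β : ℝ) (j M N : ℕ) (h : j + M < N) : (jpP β j M).degree < (N : ℕ) := by
  refine lt_of_le_of_lt (b := ((j + M : ℕ) : WithBot ℕ)) ?_ (by exact_mod_cast h)
  rw [jpP, Polynomial.degree_mul, Polynomial.degree_prod, Polynomial.degree_prod]
  simp only [Polynomial.degree_X_add_C]
  simp

set_option maxHeartbeats 1000000 in
lemma jp_int (α αh β : ℝ) (h1 : -1 < α) (hβ : -1 < β) (hZ : ∀ z : ℤ, α - αh ≠ (z : ℝ))
    (n nh j M : ℕ) (hn : 1 ≤ n) (hnh : 1 ≤ nh) (hM : j + M + 1 = n + nh) :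
    ∫ x in (0:ℝ)..1, x ^ j * JP2 α αh β n nh x * (x ^ α * (1 - x) ^ β)
      = (poch (α + (β + n + nh)) n * poch (αh + (β + n + nh)) nh) *
        (Real.Gamma (β + 1) / Real.Gamma (β + n + nh)) *
        ∑ l ∈ Finset.range n,
          jpW α αh n nh l * ((jpP β j M).eval (α + l) / (α + l + (β + n + nh))) := by
  have hn' : (1 : ℝ) ≤ n := by exact_mod_cast hn
  have hnh' : (1 : ℝ) ≤ nh := by exact_mod_cast hnh
  have hM' : (j : ℝ) + M + 1 = n + nh := by exact_mod_cast hM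
  have hmon : ∀ l : ℕ, ∀ x ∈ Set.Ioc (0:ℝ) 1,
      x ^ j * x ^ l * (x ^ α * (1 - x) ^ β)
        = x ^ ((α + l + j + 1) - 1) * (1 - x) ^ ((β + 1) - 1) := by
    intro l x hx
    rw [add_sub_cancel_right, add_sub_cancel_right, Real.rpow_add hx.1, Real.rpow_add hx.1,
      Real.rpow_natCast, Real.rpow_natCast]
    ring
  let c0 : ℝ := (-1) ^ (n + nh - 1) *
    (poch (α + β + n + nh) n * poch (αh + β + n + nh) nh /
      (((n - 1).factorial : ℝ) * poch (αh - α) nh)) *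
    (Real.Gamma (α + β + n + nh) / (Real.Gamma (β + n + nh) * Real.Gamma (α + 1)))
  let c1 : ℕ → ℝ := fun l =>
      poch (-(n : ℝ) + 1) l * poch (α + β + n + nh) l * poch (α - αh - nh + 1) l /
        (poch (α + 1) l * poch (α - αh + 1) l * (l.factorial : ℝ))
  have e : ∫ x in (0:ℝ)..1, x ^ j * JP2 α αh β n nh x * (x ^ α * (1 - x) ^ β)
      = ∫ x in (0:ℝ)..1, ∑ l ∈ Finset.range n,
        c0 * c1 l * (x ^ ((α + l + j + 1) - 1) * (1 - x) ^ ((β + 1) - 1)) := by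
    rw [intervalIntegral.integral_of_le zero_le_one, intervalIntegral.integral_of_le zero_le_one]
    refine MeasureTheory.setIntegral_congr_fun measurableSet_Ioc (fun x hx => ?_)
    rw [JP2]
    change x ^ j * (c0 * ∑ l ∈ Finset.range n, c1 l * x ^ l) * (x ^ α * (1 - x) ^ β) = _
    rw [Finset.mul_sum, Finset.mul_sum, Finset.sum_mul]
    refine Finset.sum_congr rfl fun l _ => ?_
    rw [← hmon l x hx]
    ring
  have hpos : ∀ l : ℕ, 0 < α + l + j + 1 := by
    intro l
    have : (0:ℝ) ≤ l := by positivity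
    have : (0:ℝ) ≤ j := by positivity
    linarith
  rw [e, intervalIntegral.integral_finsetSum
    (fun l _ => (jp_beta_integrable _ _ (hpos l) (by linarith)).const_mul _), Finset.mul_sum]
  refine Finset.sum_congr rfl fun l hl => ?_
  have hl0 : (0:ℝ) ≤ l := by positivity
  have hj0 : (0:ℝ) ≤ j := by positivity
  rw [intervalIntegral.integral_const_mul, jp_beta _ _ (hpos l) (by linarith), jpP_eval,
    ← jp_coef α αh n nh l (Finset.mem_range.1 hl) hZ]
  have g1 := jp_gamma_poch (α + β + n + nh) (by linarith) l
  have g2 := jp_gamma_poch (α + 1) (by linarith) l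
  have g3 := jp_gamma_poch (α + l + 1) (by linarith) j
  have g4 := jp_gamma_poch (α + l + β + j + 2) (by linarith) M
  have p1 := (jp_poch_pos (α + 1) (by linarith) l).ne'
  have G1 := (Real.Gamma_pos_of_pos (show 0 < α + 1 by linarith)).ne'
  have G2 := (Real.Gamma_pos_of_pos (show 0 < β + n + nh by linarith)).ne'
  have G3 := (Real.Gamma_pos_of_pos (show 0 < α + l + β + j + 2 by linarith)).ne'
  have G4 : α + l + (β + n + nh) ≠ 0 := by linarith
  have g5 := Real.Gamma_add_one G4
  rw [show α + l + β + j + 2 + M = α + l + (β + n + nh) + 1 by linear_combination hM', g5] at g4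
  rw [show α + β + n + nh + l = α + l + (β + n + nh) by ring] at g1
  rw [show α + l + 1 + j = α + l + j + 1 by ring] at g3
  rw [show α + 1 + l = α + l + 1 by ring] at g2
  rw [show α + l + j + 1 + (β + 1) = α + l + β + j + 2 by ring, ← g3, ← g2]
  have g6 : poch (α + l + β + j + 2) M = (α + l + (β + n + nh)) *
      (poch (α + β + n + nh) l * Real.Gamma (α + β + n + nh)) /
        Real.Gamma (α + l + β + j + 2) := by
    rw [eq_div_iff G3, g4, g1]
  rw [g6]
  simp only [c0, c1]
  rw [show α + (β + n + nh) = α + β + n + nh by ring,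
    show αh + (β + n + nh) = αh + β + n + nh by ring]
  have hne : poch (α - αh + 1) l ≠ 0 := by
    refine Finset.prod_ne_zero_iff.2 fun s _ h => hZ (-(1 + s)) ?_
    push_cast
    linarith
  have hne2 : poch (αh - α) nh ≠ 0 := by
    refine Finset.prod_ne_zero_iff.2 fun s _ h => hZ s ?_
    push_cast
    linarith
  have f1 : ((n - 1).factorial : ℝ) ≠ 0 := by positivity
  have f2 : (l.factorial : ℝ) ≠ 0 := by positivity
  clear g6 g1 g2 g3 g4 g5 e hpos hmon c0 c1
  generalize α + l + (β + n + nh) = D at *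
  generalize poch (α - αh + 1) l = x1 at *
  generalize poch (αh - α) nh = x2 at *
  generalize poch (α + 1) l = x3 at *
  generalize Real.Gamma (α + 1) = x4 at *
  generalize Real.Gamma (β + n + nh) = x5 at *
  generalize Real.Gamma (α + l + β + j + 2) = x6 at *
  field_simp

lemma jp_total (α₁ α₂ β : ℝ)
    (h₁ : -1 < α₁) (h₂ : -1 < α₂) (hβ : -1 < β)
    (hZ : ∀ z : ℤ, α₁ - α₂ ≠ (z : ℝ)) (n₁ n₂ : ℕ) (hn₁ : 1 ≤ n₁) (hn₂ : 1 ≤ n₂)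
    (j M : ℕ) (hM : j + M + 1 = n₁ + n₂) :
    (∫ x in (0:ℝ)..1, x ^ j * JP2 α₁ α₂ β n₁ n₂ x * (x ^ α₁ * (1 - x) ^ β))
      + (∫ x in (0:ℝ)..1, x ^ j * JP2 α₂ α₁ β n₂ n₁ x * (x ^ α₂ * (1 - x) ^ β))
    = (Real.Gamma (β + 1) / Real.Gamma (β + n₁ + n₂)) *
      ((-1) ^ (n₁ + n₂ + 1) * (jpP β j M).eval (-(β + n₁ + n₂))) := by
  have hn' : (1 : ℝ) ≤ n₁ := by exact_mod_cast hn₁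
  have hnh' : (1 : ℝ) ≤ n₂ := by exact_mod_cast hn₂
  rw [jp_int α₁ α₂ β h₁ hβ hZ n₁ n₂ j M hn₁ hn₂ hM,
    jp_int α₂ α₁ β h₂ hβ (fun z h => hZ (-z) (by push_cast; linarith)) n₂ n₁ j M hn₂ hn₁ (by omega),
    show β + n₂ + n₁ = β + n₁ + n₂ by ring,
    ← jp_lagrange α₁ α₂ (β + n₁ + n₂) n₁ n₂ hZ (by linarith) (by linarith) (jpP β j M)
      (jpP_degree _ _ _ _ (by omega))]
  ring

lemma jp_end (β : ℝ) (k : ℕ) :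
    poch (-(β + k + 1) + 1) k = (-1) ^ k * poch (β + 1) k := by
  rw [poch, poch, ← Finset.prod_range_reflect]
  have : ((-1:ℝ)) ^ k = ∏ _m ∈ Finset.range k, (-1:ℝ) := by simp
  rw [this, ← Finset.prod_mul_distrib]
  refine Finset.prod_congr rfl fun s hs => ?_
  have hs := Finset.mem_range.1 hs
  obtain ⟨r, rfl⟩ : ∃ r, k = s + 1 + r := ⟨k - (s + 1), by omega⟩
  rw [show s + 1 + r - 1 - s = r by omega]
  push_cast
  ring

/-- Type I orthogonality for the two-weight Jacobi–Piñeiro polynomials. -/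
theorem jacobiPineiro_typeI_orthogonality_two (α₁ α₂ β : ℝ)
    (h₁ : -1 < α₁) (h₂ : -1 < α₂) (hβ : -1 < β)
    (hZ : ∀ z : ℤ, α₁ - α₂ ≠ (z : ℝ)) (n₁ n₂ : ℕ) (hn₁ : 1 ≤ n₁) (hn₂ : 1 ≤ n₂) :
    (∀ j : ℕ, j + 2 ≤ n₁ + n₂ →
      (∫ x in (0:ℝ)..1, x ^ j * JP2 α₁ α₂ β n₁ n₂ x * (x ^ α₁ * (1 - x) ^ β))
        + (∫ x in (0:ℝ)..1, x ^ j * JP2 α₂ α₁ β n₂ n₁ x * (x ^ α₂ * (1 - x) ^ β)) = 0)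
    ∧ (∫ x in (0:ℝ)..1, x ^ (n₁ + n₂ - 1) * JP2 α₁ α₂ β n₁ n₂ x * (x ^ α₁ * (1 - x) ^ β))
        + (∫ x in (0:ℝ)..1, x ^ (n₁ + n₂ - 1) * JP2 α₂ α₁ β n₂ n₁ x * (x ^ α₂ * (1 - x) ^ β))
        = 1 := by
  constructor
  · intro j hj
    obtain ⟨M, hM⟩ : ∃ M, j + (M + 1) + 1 = n₁ + n₂ := ⟨n₁ + n₂ - j - 2, by omega⟩
    rw [jp_total α₁ α₂ β h₁ h₂ hβ hZ n₁ n₂ hn₁ hn₂ j (M + 1) hM, jpP_eval]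
    have hM' : (j : ℝ) + (M + 1) + 1 = n₁ + n₂ := by exact_mod_cast hM
    have : poch (-(β + n₁ + n₂) + β + j + 2) (M + 1) = 0 := by
      rw [poch, Finset.prod_range_succ]
      rw [show -(β + n₁ + n₂) + β + j + 2 + (M : ℝ) = 0 by linear_combination hM', mul_zero]
    rw [this]
    simp
  · obtain ⟨k, hk⟩ : ∃ k, k + 1 = n₁ + n₂ := ⟨n₁ + n₂ - 1, by omega⟩
    have hk' : (k : ℝ) + 1 = n₁ + n₂ := by exact_mod_cast hk
    rw [show n₁ + n₂ - 1 = k by omega,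
      jp_total α₁ α₂ β h₁ h₂ hβ hZ n₁ n₂ hn₁ hn₂ k 0 (by omega), jpP_eval, ← hk,
      show β + n₁ + n₂ = β + k + 1 by linear_combination -hk', jp_end]
    have g := jp_gamma_poch (β + 1) (by linarith) k
    rw [show β + 1 + k = β + k + 1 by ring] at g
    have G : Real.Gamma (β + k + 1) ≠ 0 := by
      have : (0:ℝ) ≤ k := by positivity
      exact (Real.Gamma_pos_of_pos (by linarith)).ne'
    have s1 : ((-1 : ℝ)) ^ k * (-1) ^ k = 1 := by rw [← mul_pow]; simp
    have e0 : ∀ y : ℝ, poch y 0 = 1 := fun y => by simp [poch]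
    rw [e0, show ((-1 : ℝ)) ^ (k + 1 + 1) = (-1) ^ k by ring]
    field_simp
    linear_combination g + Real.Gamma (β + 1) * poch (β + 1) k * s1
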